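/- (Ellentuck's theorem, part 3.) Let [ℕ]^ω carry the Ellentuck topology. If [ℕ]^ω = ⋃_{i=1}^{k} 𝒫_i is a finite partition of [ℕ]^ω in which every piece 𝒫_i has the Baire property in the Ellentuck topology, then there exist H ∈ [ℕ]^ω and i ∈ {1,…,k} such that [H]^ω ⊆ 𝒫_i, where [H]^ω is the set of infinite subsets of H. -/

import Mathlib

open scoped Topology

namespace Ellentuck

/-- `[ℕ]^ω`, the set of infinite subsets of `ℕ`. -/
abbrev InfSet : Type := {A : Set ℕ // A.Infinite}

/-- `s ⊏ A` : the finite set `s` is an initial segment of `A`,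
i.e. `s = {n ∈ A : n ≤ max s}` (which for `s = ∅` says `s = ∅`). -/
def InitSeg (s : Finset ℕ) (A : Set ℕ) : Prop :=
  (s : Set ℕ) = {n | n ∈ A ∧ (n : WithBot ℕ) ≤ s.max}

/-- The Ellentuck basic set `[s, B] = {A ∈ [ℕ]^ω : A ⊆ B ∧ s ⊏ A}`. -/
def seg (s : Finset ℕ) (B : InfSet) : Set InfSet :=
  {A | A.1 ⊆ B.1 ∧ InitSeg s A.1}

/-- Basic open sets of the Ellentuck topology. -/
def IsBasic (U : Set InfSet) : Prop := ∃ (s : Finset ℕ) (B : InfSet), U = seg s B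

/-- The Ellentuck topology on `[ℕ]^ω`, generated by the sets `[s,B]`. -/
def ellentuckTop : TopologicalSpace InfSet :=
  TopologicalSpace.generateFrom {U | IsBasic U}

/-- `𝒩` is nowhere dense: every nonempty basic open set contains a nonempty basic open
subset disjoint from `𝒩`. -/
def Nwd (X : Set InfSet) : Prop :=
  ∀ U : Set InfSet, IsBasic U → U.Nonempty →
    ∃ V : Set InfSet, IsBasic V ∧ V.Nonempty ∧ V ⊆ U ∧ V ∩ X = ∅

/-- `𝒳` is meager: a countable union of nowhere dense sets. -/
def Meager (X : Set InfSet) : Prop :=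
  ∃ f : ℕ → Set InfSet, (∀ i, Nwd (f i)) ∧ X = ⋃ i, f i

/-- `𝒳` has the abstract Baire property. -/
def ABP (X : Set InfSet) : Prop :=
  ∀ U : Set InfSet, IsBasic U → U.Nonempty →
    ∃ V : Set InfSet, IsBasic V ∧ V.Nonempty ∧ V ⊆ U ∧ (V ⊆ X ∨ V ∩ X = ∅)

/-- `𝒳` has the Baire property: `𝒳 △ 𝒪` is meager for some open set `𝒪` of the
Ellentuck topology. -/
def BP (X : Set InfSet) : Prop :=
  ∃ O : Set InfSet, IsOpen[ellentuckTop] O ∧ Meager (symmDiff X O)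

/-- `𝒜 ⊆ [ℕ]^ω` is Ramsey. -/
def IsRamsey (X : Set InfSet) : Prop :=
  ∀ (N : InfSet) (s : Finset ℕ), (s : Set ℕ) ⊆ N.1 →
    ∃ M : InfSet, M.1 ⊆ N.1 ∧ (s : Set ℕ) ⊆ M.1 ∧ (seg s M ⊆ X ∨ seg s M ∩ X = ∅)

/-- `𝒜 ⊆ [ℕ]^ω` is Ramsey null. -/
def IsRamseyNull (X : Set InfSet) : Prop :=
  ∀ (N : InfSet) (s : Finset ℕ), (s : Set ℕ) ⊆ N.1 →
    ∃ M : InfSet, M.1 ⊆ N.1 ∧ (s : Set ℕ) ⊆ M.1 ∧ seg s M ∩ X = ∅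

theorem initSeg_iff {s : Finset ℕ} {A : Set ℕ} :
    InitSeg s A ↔ (s : Set ℕ) ⊆ A ∧ ∀ x ∈ A, x ∉ s → ∀ y ∈ s, y < x := by
  constructor
  · intro h
    have h' : ∀ x, x ∈ s ↔ x ∈ A ∧ (x : WithBot ℕ) ≤ s.max := fun x => by
      simpa using Set.ext_iff.mp h x
    refine ⟨fun x hx => ((h' x).1 hx).1, fun x hx hxs y hy => ?_⟩
    by_contra! hxy
    exact hxs ((h' x).2 ⟨hx, (WithBot.coe_le_coe.2 hxy).trans (Finset.le_max hy)⟩)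
  · rintro ⟨hsub, hlt⟩
    ext x
    refine ⟨fun hx => ⟨hsub hx, Finset.le_max hx⟩, fun ⟨hxA, hx⟩ => ?_⟩
    by_contra hxs
    rcases s.eq_empty_or_nonempty with rfl | hs
    · simp at hx
    · rw [← Finset.coe_max' hs] at hx
      exact absurd (hlt x hxA hxs _ (s.max'_mem hs)) (not_lt.2 (WithBot.coe_le_coe.1 hx))

/-- The sets `A` with initial segment `s` and all remaining elements in `B`. Unlike in `seg s B`,
the stem `s` need not be contained in `B`. -/
def stemNhd (s : Finset ℕ) (B : Set ℕ) : Set InfSet :=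
  {A | (s : Set ℕ) ⊆ A.1 ∧ ∀ x ∈ A.1, x ∉ s → x ∈ B ∧ ∀ y ∈ s, y < x}

theorem stemNhd_mono {s : Finset ℕ} {B C : Set ℕ}
    (h : ∀ x ∈ B, (∀ y ∈ s, y < x) → x ∈ C) : stemNhd s B ⊆ stemNhd s C :=
  fun _ hA => ⟨hA.1, fun x hx hxs =>
    ⟨h x (hA.2 x hx hxs).1 (hA.2 x hx hxs).2, (hA.2 x hx hxs).2⟩⟩

theorem stemNhd_eq_seg (s : Finset ℕ) {B : Set ℕ} (hB : B.Infinite) :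
    stemNhd s B = seg s ⟨s ∪ B, hB.mono Set.subset_union_right⟩ := by
  ext A
  simp only [stemNhd, seg, initSeg_iff, Set.mem_ofPred_eq, Set.subset_def, Set.mem_union,
    Finset.mem_coe]
  grind

theorem isBasic_stemNhd (s : Finset ℕ) {B : Set ℕ} (hB : B.Infinite) :
    IsBasic (stemNhd s B) :=
  ⟨s, _, stemNhd_eq_seg s hB⟩

theorem infinite_sep_above {B : Set ℕ} (hB : B.Infinite) (s : Finset ℕ) :
    {x ∈ B | ∀ y ∈ s, y < x}.Infinite := by
  refine (hB.sdiff (Set.finite_Iic (s.sup id))).mono fun x hx => ⟨hx.1, fun y hy => ?_⟩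
  exact (Finset.le_sup (f := id) hy).trans_lt (not_le.1 hx.2)

theorem stemNhd_nonempty (s : Finset ℕ) {B : Set ℕ} (hB : B.Infinite) :
    (stemNhd s B).Nonempty := by
  refine ⟨⟨s ∪ {x ∈ B | ∀ y ∈ s, y < x},
    (infinite_sep_above hB s).mono Set.subset_union_right⟩, Set.subset_union_left, ?_⟩
  rintro x (hx | hx) hxs
  · exact absurd hx hxs
  · exact hx

theorem stemNhd_empty (B : Set ℕ) : stemNhd ∅ B = {A | A.1 ⊆ B} := by
  ext A
  simp [stemNhd, Set.subset_def]

/-- Fusion: a hereditary property of pairs `(s, B)` which can be achieved by shrinking `B` holds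
simultaneously for all finite subsets `s` of some infinite set. -/
theorem exists_fusion (φ : Finset ℕ → Set ℕ → Prop)
    (hered : ∀ s B C, (∀ x ∈ C, (∀ y ∈ s, y < x) → x ∈ B) → φ s B → φ s C)
    {N : Set ℕ} (hN : N.Infinite)
    (dense : ∀ s, ∀ B ⊆ N, B.Infinite → ∃ C ⊆ B, C.Infinite ∧ φ s C) :
    ∃ M ⊆ N, M.Infinite ∧ ∀ s : Finset ℕ, (s : Set ℕ) ⊆ M → φ s M := by
  have hfin : ∀ (F : Finset (Finset ℕ)), ∀ B ⊆ N, B.Infinite →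
      ∃ C ⊆ B, C.Infinite ∧ ∀ s ∈ F, φ s C := by
    intro F
    induction F using Finset.induction_on with
    | empty => exact fun B _ hB => ⟨B, subset_rfl, hB, by simp⟩
    | insert s F _ ih =>
      intro B hBN hB
      obtain ⟨C, hCB, hC, hφ⟩ := ih B hBN hB
      obtain ⟨D, hDC, hD, hs⟩ := dense s C (hCB.trans hBN) hC
      refine ⟨D, hDC.trans hCB, hD, fun t ht => ?_⟩
      rcases Finset.mem_insert.1 ht with rfl | ht
      · exact hs
      · exact hered t C D (fun x hx _ => hDC hx) (hφ t ht)
  have hstep : ∀ B : {B : Set ℕ // B ⊆ N ∧ B.Infinite},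
      ∃ p : ℕ × {B : Set ℕ // B ⊆ N ∧ B.Infinite}, p.1 ∈ B.1 ∧ p.2.1 ⊆ B.1 ∧
        (∀ x ∈ p.2.1, p.1 < x) ∧ ∀ s ⊆ Finset.range (p.1 + 1), φ s p.2.1 := by
    rintro ⟨B, hBN, hB⟩
    obtain ⟨n, hn⟩ := hB.nonempty
    have hB' : {x ∈ B | ∀ y ∈ ({n} : Finset ℕ), y < x} ⊆ B := Set.sep_subset _ _
    obtain ⟨C, hCB, hC, hφ⟩ := hfin (Finset.range (n + 1)).powerset _ (hB'.trans hBN)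
      (infinite_sep_above hB {n})
    exact ⟨(n, ⟨C, (hCB.trans hB').trans hBN, hC⟩), hn, hCB.trans hB',
      fun x hx => (hCB hx).2 n (Finset.mem_singleton_self n),
      fun s hs => hφ s (Finset.mem_powerset.2 hs)⟩
  choose next hmem hsub hlt hφ using hstep
  obtain ⟨B₀, hB₀N, hB₀, hφ₀⟩ := dense ∅ N subset_rfl hN
  let B : ℕ → {B : Set ℕ // B ⊆ N ∧ B.Infinite} :=
    fun i => Nat.rec ⟨B₀, hB₀N, hB₀⟩ (fun _ C => (next C).2) i
  let n : ℕ → ℕ := fun i => (next (B i)).1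
  have hanti : Antitone fun i => (B i).1 := antitone_nat_of_succ_le fun i => hsub (B i)
  have hnB : ∀ i, n i ∈ (B i).1 := fun i => hmem (B i)
  have hmono : StrictMono n := strictMono_nat_of_lt_succ fun i => hlt (B i) _ (hnB (i + 1))
  refine ⟨Set.range n, ?_, Set.infinite_range_of_injective hmono.injective, fun s hs => ?_⟩
  · rintro _ ⟨i, rfl⟩
    exact (B i).2.1 (hnB i)
  · rcases s.eq_empty_or_nonempty with rfl | hne
    · refine hered _ _ _ ?_ hφ₀
      rintro _ ⟨i, rfl⟩ _
      exact hanti (Nat.zero_le i) (hnB i)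
    · obtain ⟨i, hi⟩ := hs (s.max'_mem hne)
      refine hered _ _ _ ?_ (hφ (B i) s fun x hx => ?_)
      · rintro _ ⟨j, rfl⟩ hj
        have hij : i < j := hmono.lt_iff_lt.1 (hi ▸ hj _ (s.max'_mem hne))
        exact hanti (Nat.succ_le_of_lt hij) (hnB j)
      · exact Finset.mem_range.2 (Nat.lt_succ_of_le ((s.le_max' x hx).trans_eq hi.symm))

theorem exists_bound_of_isOpen {O : Set InfSet} (hO : IsOpen[ellentuckTop] O) :
    ∀ A ∈ O, ∃ n, ∀ D : InfSet, D.1 ⊆ A.1 → (∀ x ∈ A.1, x ≤ n → x ∈ D.1) → D ∈ O := by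
  induction hO with
  | basic U hU =>
    obtain ⟨s, B, rfl⟩ := hU
    rintro A ⟨hAB, hA⟩
    rw [initSeg_iff] at hA
    refine ⟨s.sup id, fun D hDA hD => ⟨hDA.trans hAB, initSeg_iff.2 ⟨fun x hx => ?_, ?_⟩⟩⟩
    · exact hD x (hA.1 hx) (Finset.le_sup (f := id) hx)
    · exact fun x hx => hA.2 x (hDA hx)
  | univ => exact fun A _ => ⟨0, fun D _ _ => trivial⟩
  | inter U V _ _ ihU ihV =>
    rintro A ⟨hAU, hAV⟩
    obtain ⟨m, hm⟩ := ihU A hAU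
    obtain ⟨n, hn⟩ := ihV A hAV
    exact ⟨max m n, fun D hDA hD =>
      ⟨hm D hDA fun x hx hxm => hD x hx (le_max_of_le_left hxm),
        hn D hDA fun x hx hxn => hD x hx (le_max_of_le_right hxn)⟩⟩
  | sUnion S _ ih =>
    rintro A ⟨U, hU, hAU⟩
    obtain ⟨n, hn⟩ := ih U hU A hAU
    exact ⟨n, fun D hDA hD => ⟨U, hU, hn D hDA hD⟩⟩

/-- No infinite subset `C` of `B` satisfies `stemNhd s C ⊆ O`. -/
def Rejects (O : Set InfSet) (s : Finset ℕ) (B : Set ℕ) : Prop :=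
  ∀ C ⊆ B, C.Infinite → ¬ stemNhd s C ⊆ O

theorem Rejects.of_tail {O : Set InfSet} {s : Finset ℕ} {B C : Set ℕ} (h : Rejects O s B)
    (hCB : ∀ x ∈ C, (∀ y ∈ s, y < x) → x ∈ B) : Rejects O s C := by
  intro D hDC hD hDO
  refine h {x ∈ D | ∀ y ∈ s, y < x} (fun x hx => hCB x (hDC hx.1) hx.2)
    (infinite_sep_above hD s) ((stemNhd_mono fun x hx _ => hx.1).trans hDO)

theorem stemNhd_subset_of_insert {O : Set InfSet} {s : Finset ℕ} {B C : Set ℕ} (hCB : C ⊆ B)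
    (h : ∀ n ∈ C, stemNhd (insert n s) B ⊆ O) : stemNhd s C ⊆ O := by
  classical
  intro A hA
  have hne : ∃ n, n ∈ A.1 ∧ n ∉ s := A.2.exists_notMem_finset s
  obtain ⟨hnA, hns⟩ := Nat.find_spec hne
  refine h _ (hA.2 _ hnA hns).1 ⟨?_, fun x hx hxs => ?_⟩
  · rw [Finset.coe_insert]
    exact Set.insert_subset hnA hA.1
  · rw [Finset.mem_insert, not_or] at hxs
    refine ⟨hCB (hA.2 x hx hxs.2).1, fun y hy => ?_⟩
    rcases Finset.mem_insert.1 hy with rfl | hy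
    · exact lt_of_le_of_ne (Nat.find_min' hne ⟨hx, hxs.2⟩) (Ne.symm hxs.1)
    · exact (hA.2 x hx hxs.2).2 y hy

theorem exists_forall_decides (O : Set InfSet) (s : Finset ℕ) {B : Set ℕ} (hB : B.Infinite) :
    ∃ M ⊆ B, M.Infinite ∧ ∀ t : Finset ℕ, (t : Set ℕ) ⊆ M →
      stemNhd (s ∪ t) M ⊆ O ∨ Rejects O (s ∪ t) M := by
  refine exists_fusion (fun t C => stemNhd (s ∪ t) C ⊆ O ∨ Rejects O (s ∪ t) C) ?_ hB ?_
  · intro t C D hDC h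
    have hDC' : ∀ x ∈ D, (∀ y ∈ s ∪ t, y < x) → x ∈ C := fun x hx hxy =>
      hDC x hx fun y hy => hxy y (Finset.mem_union_right _ hy)
    exact h.imp (stemNhd_mono hDC').trans fun h => h.of_tail hDC'
  · intro t C _ hC
    by_cases h : Rejects O (s ∪ t) C
    · exact ⟨C, subset_rfl, hC, Or.inr h⟩
    · unfold Rejects at h
      push Not at h
      obtain ⟨D, hDC, hD, hDO⟩ := h
      exact ⟨D, hDC, hD, Or.inl hDO⟩

theorem exists_forall_rejects {O : Set InfSet} {s : Finset ℕ} {M : Set ℕ} (hM : M.Infinite)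
    (hdec : ∀ t : Finset ℕ, (t : Set ℕ) ⊆ M →
      stemNhd (s ∪ t) M ⊆ O ∨ Rejects O (s ∪ t) M)
    (hrej : Rejects O s M) :
    ∃ L ⊆ M, L.Infinite ∧ ∀ t : Finset ℕ, (t : Set ℕ) ⊆ L → (∀ x ∈ s, ∀ y ∈ t, x < y) →
      Rejects O (s ∪ t) M := by
  obtain ⟨L, hLM, hL, h⟩ := exists_fusion
    (fun t C => (t : Set ℕ) ⊆ M → Rejects O (s ∪ t) M →
      ∀ n ∈ C, (∀ y ∈ s ∪ t, y < n) → Rejects O (insert n (s ∪ t)) M)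
    (fun t C D hDC h htM ht n hn hlt =>
      h htM ht n (hDC n hn fun y hy => hlt y (Finset.mem_union_right _ hy)) hlt) hM
    (by
      intro t B hBM hB
      by_cases ht : (t : Set ℕ) ⊆ M ∧ Rejects O (s ∪ t) M
      swap
      · exact ⟨B, subset_rfl, hB, fun h₁ h₂ => absurd ⟨h₁, h₂⟩ ht⟩
      have hfin : {n ∈ B | stemNhd (insert n (s ∪ t)) M ⊆ O}.Finite := by
        by_contra hinf
        exact ht.2 _ ((Set.sep_subset _ _).trans hBM) hinf
          (stemNhd_subset_of_insert ((Set.sep_subset _ _).trans hBM) fun n hn => hn.2)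
      refine ⟨B \ _, Set.sdiff_subset, hB.sdiff hfin, fun _ _ n hn _ => ?_⟩
      have hdn := hdec (insert n t) (by
        rw [Finset.coe_insert]
        exact Set.insert_subset (hBM hn.1) ht.1)
      rw [Finset.union_insert] at hdn
      exact hdn.resolve_left fun hO => hn.2 ⟨hn.1, hO⟩)
  refine ⟨L, hLM, hL, fun t => ?_⟩
  induction t using Finset.induction_on_max with
  | empty => simpa using hrej
  | insert n t hlt ih =>
    intro ht hst
    rw [Finset.coe_insert, Set.insert_subset_iff] at ht
    rw [Finset.union_insert]
    refine h t ht.2 (ht.2.trans hLM)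
      (ih ht.2 fun x hx y hy => hst x hx y (Finset.mem_insert_of_mem hy)) n ht.1 fun y hy => ?_
    rcases Finset.mem_union.1 hy with hy | hy
    · exact hst y hy n (Finset.mem_insert_self n t)
    · exact hlt y hy

/-- Open sets are completely Ramsey. -/
theorem exists_homogeneous_of_isOpen {O : Set InfSet} (hO : IsOpen[ellentuckTop] O)
    (s : Finset ℕ) {B : Set ℕ} (hB : B.Infinite) :
    ∃ C ⊆ B, C.Infinite ∧ (stemNhd s C ⊆ O ∨ Disjoint (stemNhd s C) O) := by
  classical
  obtain ⟨M, hMB, hM, hdec⟩ := exists_forall_decides O s hB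
  rcases hdec ∅ (by simp) with h | hrej
  · exact ⟨M, hMB, hM, Or.inl (by simpa using h)⟩
  rw [Finset.union_empty] at hrej
  obtain ⟨L, hLM, hL, h⟩ := exists_forall_rejects hM hdec hrej
  refine ⟨L, hLM.trans hMB, hL, Or.inr (Set.disjoint_left.2 fun A hA hAO => ?_)⟩
  obtain ⟨n, hn⟩ := exists_bound_of_isOpen hO A hAO
  let t : Finset ℕ := {x ∈ Finset.range (n + 1) | x ∈ A.1 ∧ x ∉ s}
  have ht : ∀ x, x ∈ t ↔ x ≤ n ∧ x ∈ A.1 ∧ x ∉ s := by simp [t]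
  have hAL : (A.1 \ s) ⊆ L := fun x hx => (hA.2 x hx.1 hx.2).1
  refine h t (fun x hx => hAL ((ht x).1 hx).2)
    (fun x hx y hy => (hA.2 y ((ht y).1 hy).2.1 ((ht y).1 hy).2.2).2 x hx)
    (A.1 \ s) (hAL.trans hLM) (A.2.sdiff s.finite_toSet) fun D hD => hn D (fun x hx => ?_) ?_
  · by_cases hxs : x ∈ s ∪ t
    · rcases Finset.mem_union.1 hxs with hxs | hxt
      · exact hA.1 hxs
      · exact ((ht x).1 hxt).2.1
    · exact (hD.2 x hx hxs).1.1
  · intro x hx hxn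
    refine hD.1 (Finset.mem_union.2 ?_)
    by_cases hxs : x ∈ s
    · exact Or.inl hxs
    · exact Or.inr ((ht x).2 ⟨hxn, hx, hxs⟩)

theorem Nwd.exists_disjoint {X : Set InfSet} (hX : Nwd X) (s : Finset ℕ) {B : Set ℕ}
    (hB : B.Infinite) : ∃ C ⊆ B, C.Infinite ∧ Disjoint (stemNhd s C) X := by
  have hO : IsOpen[ellentuckTop] (⋃₀ {U | IsBasic U ∧ Disjoint U X}) :=
    .sUnion _ fun U hU => .basic U hU.1
  obtain ⟨C, hCB, hC, h | h⟩ := exists_homogeneous_of_isOpen hO s hB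
  · refine ⟨C, hCB, hC, Set.disjoint_left.2 fun A hA hAX => ?_⟩
    obtain ⟨U, hU, hAU⟩ := h hA
    exact Set.disjoint_left.1 hU.2 hAU hAX
  · obtain ⟨V, hV, ⟨A, hA⟩, hVsub, hVX⟩ :=
      hX _ (isBasic_stemNhd s hC) (stemNhd_nonempty s hC)
    exact absurd ⟨V, ⟨hV, Set.disjoint_iff_inter_eq_empty.2 hVX⟩, hA⟩
      (Set.disjoint_left.1 h (hVsub hA))

theorem exists_disjoint_iUnion_nwd {f : ℕ → Set InfSet} (hf : ∀ i, Nwd (f i)) {B : Set ℕ}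
    (hB : B.Infinite) : ∃ C ⊆ B, C.Infinite ∧ ∀ A : InfSet, A.1 ⊆ C → A ∉ ⋃ i, f i := by
  classical
  obtain ⟨C, hCB, hC, h⟩ := exists_fusion
    (fun s C => ∀ i ≤ s.sup id, Disjoint (stemNhd s C) (f i))
    (fun s C D hDC h i hi => (h i hi).mono_left (stemNhd_mono hDC)) hB
    (by
      intro s B _ hB
      generalize s.sup id = n
      induction n with
      | zero =>
        obtain ⟨C, hCB, hC, h⟩ := (hf 0).exists_disjoint s hB
        exact ⟨C, hCB, hC, fun i hi => Nat.le_zero.1 hi ▸ h⟩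
      | succ n ih =>
        obtain ⟨C, hCB, hC, h⟩ := ih
        obtain ⟨D, hDC, hD, h'⟩ := (hf (n + 1)).exists_disjoint s hC
        refine ⟨D, hDC.trans hCB, hD, fun i hi => ?_⟩
        rcases Nat.le_succ_iff.1 hi with hi | rfl
        · exact (h i hi).mono_left (stemNhd_mono fun x hx _ => hDC hx)
        · exact h')
  refine ⟨C, hCB, hC, fun A hAC hA => ?_⟩
  obtain ⟨i, hi⟩ := Set.mem_iUnion.1 hA
  obtain ⟨m, hmA, hm⟩ := A.2.exists_gt i
  let s : Finset ℕ := {x ∈ Finset.range (m + 1) | x ∈ A.1}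
  have hs : ∀ x, x ∈ s ↔ x ≤ m ∧ x ∈ A.1 := by simp [s]
  refine Set.disjoint_left.1 (h s (fun x hx => hAC ((hs x).1 hx).2) i
    (hm.le.trans (Finset.le_sup (f := id) ((hs m).2 ⟨le_rfl, hmA⟩))))
    ⟨fun x hx => ((hs x).1 hx).2, fun x hx hxs => ⟨hAC hx, fun y hy => ?_⟩⟩ hi
  exact ((hs y).1 hy).1.trans_lt (not_le.1 fun hxm => hxs ((hs x).2 ⟨hxm, hx⟩))

theorem BP.exists_homogeneous {X : Set InfSet} (hX : BP X) {B : Set ℕ} (hB : B.Infinite) :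
    ∃ C ⊆ B, C.Infinite ∧ ((∀ A : InfSet, A.1 ⊆ C → A ∈ X) ∨ ∀ A : InfSet, A.1 ⊆ C → A ∉ X) := by
  obtain ⟨O, hO, f, hf, hfO⟩ := hX
  obtain ⟨C, hCB, hC, hCf⟩ := exists_disjoint_iUnion_nwd hf hB
  rw [← hfO] at hCf
  obtain ⟨D, hDC, hD, h⟩ := exists_homogeneous_of_isOpen hO ∅ hC
  rw [stemNhd_empty, Set.disjoint_left] at h
  have hiff : ∀ A : InfSet, A.1 ⊆ D → (A ∈ X ↔ A ∈ O) := fun A hA => by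
    have := hCf A (hA.trans hDC)
    rw [Set.mem_symmDiff] at this
    tauto
  exact ⟨D, hDC.trans hCB, hD, h.imp (fun h A hA => (hiff A hA).2 (h hA))
    fun h A hA hAX => h hA ((hiff A hA).1 hAX)⟩

theorem exists_homogeneous_finset {ι : Type*} {P : ι → Set InfSet} (hP : ∀ i, BP (P i))
    (F : Finset ι) : ∃ C : Set ℕ, C.Infinite ∧
      ((∃ i, ∀ A : InfSet, A.1 ⊆ C → A ∈ P i) ∨ ∀ i ∈ F, ∀ A : InfSet, A.1 ⊆ C → A ∉ P i) := by
  classical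
  induction F using Finset.induction_on with
  | empty => exact ⟨Set.univ, Set.infinite_univ, Or.inr (by simp)⟩
  | insert i F _ ih =>
    obtain ⟨C, hC, h | h⟩ := ih
    · exact ⟨C, hC, Or.inl h⟩
    · obtain ⟨D, hDC, hD, h' | h'⟩ := (hP i).exists_homogeneous hC
      · exact ⟨D, hD, Or.inl ⟨i, h'⟩⟩
      · refine ⟨D, hD, Or.inr fun j hj A hA => ?_⟩
        rcases Finset.mem_insert.1 hj with rfl | hj
        · exact h' A hA
        · exact h j hj A (hA.trans hDC)

/-- **Ellentuck's theorem, part 3.** If `[ℕ]^ω` is partitioned into finitely many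
pieces, each with the Baire property in the Ellentuck topology, then there are `H ∈ [ℕ]^ω` and
a piece containing `[H]^ω`. -/
theorem ellentuck_part3 (k : ℕ) (P : Fin k → Set InfSet)
    (hcover : (⋃ i, P i) = (Set.univ : Set InfSet))
    (hdisj : ∀ i j, i ≠ j → P i ∩ P j = ∅)
    (hBP : ∀ i, BP (P i)) :
    ∃ (H : InfSet) (i : Fin k), {A : InfSet | A.1 ⊆ H.1} ⊆ P i := by
  obtain ⟨C, hC, ⟨i, h⟩ | h⟩ := exists_homogeneous_finset hBP Finset.univ
  · exact ⟨⟨C, hC⟩, i, fun A hA => h A hA⟩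
  · obtain ⟨i, hi⟩ := Set.mem_iUnion.1 (hcover ▸ Set.mem_univ (⟨C, hC⟩ : InfSet))
    exact absurd hi (h i (Finset.mem_univ i) _ subset_rfl)

end Ellentuck
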